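/- Let I be an ideal on a set A, let θ be an infinite cardinal with θ⁺ regular, and let ⟨g_ζ : ζ < θ⁺⟩ be a sequence of functions from A to the ordinals which is ≤_I-increasing, i.e., for ζ < ξ < θ⁺ the set {a ∈ A : g_ζ(a) > g_ξ(a)} belongs to I. Then there exists a club (closed unbounded) subset C of θ⁺ such that exactly one of the following holds: either for all ζ ≤ ξ both in C one has g_ζ =_I g_ξ (i.e., {a ∈ A : g_ζ(a) ≠ g_ξ(a)} ∈ I), or for all ζ < ξ both in C one has ¬(g_ζ =_I g_ξ). -/

import Mathlib

open Cardinal Ordinal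

/-- If an ordinal-valued sequence of functions is increasing modulo an ideal and two members agree
modulo the ideal, then so do any two members between them. -/
theorem ne_set_mem_of_le_of_le {A : Type} {I : Set (Set A)}
    (hIdown : ∀ u ∈ I, ∀ v ⊆ u, v ∈ I) (hIunion : ∀ u ∈ I, ∀ v ∈ I, u ∪ v ∈ I)
    {κ : Ordinal.{0}} {g : Ordinal.{0} → A → Ordinal.{0}}
    (hg : ∀ ζ ξ : Ordinal, ζ ≤ ξ → ξ < κ → {a : A | g ξ a < g ζ a} ∈ I)
    {ζ ζ' ξ' ξ : Ordinal} (h₁ : ζ ≤ ζ') (h₂ : ζ' ≤ ξ') (h₃ : ξ' ≤ ξ) (hξ : ξ < κ)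
    (h : {a : A | g ζ a ≠ g ξ a} ∈ I) : {a : A | g ζ' a ≠ g ξ' a} ∈ I := by
  have hξ' := h₃.trans_lt hξ
  refine hIdown _ (hIunion _ (hIunion _ (hg _ _ h₁ (h₂.trans_lt hξ')) _ (hg _ _ h₃ hξ)) _
    (hIunion _ (hg _ _ h₂ hξ') _ h)) _ fun a ha => ?_
  by_contra hn
  simp only [Set.mem_union, Set.mem_ofPred_eq, not_or, not_lt, ne_eq, not_not] at hn
  obtain ⟨⟨h1, h3⟩, h2, h4⟩ := hn
  exact ha (h2.antisymm (h3.trans (h4.symm.le.trans h1)))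

/-- For a `≤_I`-increasing sequence `⟨g_ζ : ζ < θ⁺⟩` of ordinal-valued functions
there is a club `C ⊆ θ⁺` on which either any two members of the sequence are
`=_I`-equivalent, or no two distinct members are `=_I`-equivalent. -/
theorem exists_club_constant_or_changing
    {A : Type} (I : Set (Set A))
    (hIdown : ∀ u ∈ I, ∀ v ⊆ u, v ∈ I)
    (hIunion : ∀ u ∈ I, ∀ v ∈ I, u ∪ v ∈ I)
    (hIproper : (Set.univ : Set A) ∉ I)
    (θ : Cardinal.{0}) (hθ : ℵ₀ ≤ θ) (hreg : (Order.succ θ).IsRegular)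
    (g : Ordinal.{0} → A → Ordinal.{0})
    (hg : ∀ ζ ξ : Ordinal, ζ < ξ → ξ < (Order.succ θ).ord →
      {a : A | g ξ a < g ζ a} ∈ I) :
    ∃ C : Set Ordinal,
      C ⊆ Set.Iio (Order.succ θ).ord ∧
      -- unbounded in θ⁺
      (∀ α < (Order.succ θ).ord, ∃ β ∈ C, α < β) ∧
      -- closed under suprema of bounded nonempty subsets
      (∀ s ⊆ C, s.Nonempty → (∃ b < (Order.succ θ).ord, ∀ x ∈ s, x ≤ b) →
        sSup s ∈ C) ∧
      -- exactly one of the two alternatives holds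
      Xor'
        (∀ ζ ∈ C, ∀ ξ ∈ C, ζ ≤ ξ → {a : A | g ζ a ≠ g ξ a} ∈ I)
        (∀ ζ ∈ C, ∀ ξ ∈ C, ζ < ξ → {a : A | g ζ a ≠ g ξ a} ∉ I) := by
  set κ := (Order.succ θ).ord with hκ
  have hlim : Order.IsSuccLimit κ := isSuccLimit_ord (hθ.trans (Order.le_succ θ))
  have hpos : 0 < κ := hlim.bot_lt
  have hempty : ∅ ∈ I :=
    hIdown _ (hg 0 _ (Order.lt_succ 0) (hlim.succ_lt hpos)) _ (Set.empty_subset _)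
  have hg' : ∀ ζ ξ : Ordinal, ζ ≤ ξ → ξ < κ → {a : A | g ξ a < g ζ a} ∈ I := by
    intro ζ ξ h hξ
    rcases h.eq_or_lt with rfl | h
    · simpa using hempty
    · exact hg ζ ξ h hξ
  by_cases hconst : ∃ ζ₀ < κ, ∀ ξ, ζ₀ < ξ → ξ < κ → {a : A | g ζ₀ a ≠ g ξ a} ∈ I
  · obtain ⟨ζ₀, hζ₀, hc⟩ := hconst
    have hall : ∀ ζ ∈ Set.Ico ζ₀ κ, ∀ ξ ∈ Set.Ico ζ₀ κ, ζ ≤ ξ →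
        {a : A | g ζ a ≠ g ξ a} ∈ I := by
      intro ζ hζ ξ hξ h
      rcases hξ.1.eq_or_lt with rfl | hlt
      · simpa [h.antisymm hζ.1] using hempty
      · exact ne_set_mem_of_le_of_le hIdown hIunion hg' hζ.1 h le_rfl hξ.2 (hc ξ hlt hξ.2)
    refine ⟨Set.Ico ζ₀ κ, fun _ h => h.2, fun α hα => ?_, ?_, Or.inl ⟨hall, fun hne => ?_⟩⟩
    · exact ⟨max ζ₀ (Order.succ α), ⟨le_max_left _ _, max_lt hζ₀ (hlim.succ_lt hα)⟩,
        (Order.lt_succ α).trans_le (le_max_right _ _)⟩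
    · rintro s hs ⟨x, hx⟩ ⟨b, hb, hsb⟩
      exact ⟨(hs hx).1.trans (le_csSup ⟨b, hsb⟩ hx), (csSup_le ⟨x, hx⟩ hsb).trans_lt hb⟩
    · have hmem : ζ₀ ∈ Set.Ico ζ₀ κ := ⟨le_rfl, hζ₀⟩
      have hmem' : Order.succ ζ₀ ∈ Set.Ico ζ₀ κ := ⟨Order.le_succ _, hlim.succ_lt hζ₀⟩
      exact hne _ hmem _ hmem' (Order.lt_succ _) (hall _ hmem _ hmem' (Order.le_succ _))
  · push Not at hconst
    choose! f hf hfκ hne using hconst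
    have hunb : ∀ α < κ, ∃ β ∈ {δ | δ < κ ∧ ∀ ζ < δ, {a : A | g ζ a ≠ g δ a} ∉ I}, α < β := by
      intro α hα
      have hiter : ∀ n : ℕ, f^[n] α < κ := by
        intro n
        induction n with
        | zero => exact hα
        | succ n ih => rw [Function.iterate_succ_apply']; exact hfκ _ ih
      have hsup : ⨆ n : ℕ, f^[n] α < κ := by
        refine iSup_lt_of_lt_cof ?_ hiter
        rw [hκ, hreg.cof_ord, mk_nat]
        exact hθ.trans_lt (Order.lt_succ θ)
      have hle : ∀ n : ℕ, f (f^[n] α) ≤ ⨆ n : ℕ, f^[n] α := fun n => by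
        rw [← Function.iterate_succ_apply' f n α]
        exact Ordinal.le_iSup (fun n : ℕ => f^[n] α) (n + 1)
      refine ⟨⨆ n : ℕ, f^[n] α, ⟨hsup, fun ζ hζ hmem => ?_⟩, (hf α hα).trans_le (hle 0)⟩
      obtain ⟨n, hn⟩ := Ordinal.lt_iSup_iff.1 hζ
      exact hne _ (hiter n) (ne_set_mem_of_le_of_le hIdown hIunion hg' hn.le
        (hf _ (hiter n)).le (hle n) hsup hmem)
    refine ⟨{δ | δ < κ ∧ ∀ ζ < δ, {a : A | g ζ a ≠ g δ a} ∉ I}, fun _ h => h.1, hunb, ?_,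
      Or.inr ⟨fun ζ _ ξ hξ h => hξ.2 ζ h, fun hall => ?_⟩⟩
    · rintro s hs hsne ⟨b, hb, hsb⟩
      have hsup := (csSup_le hsne hsb).trans_lt hb
      refine ⟨hsup, fun ζ hζ hmem => ?_⟩
      obtain ⟨x, hx, hζx⟩ := exists_lt_of_lt_csSup hsne hζ
      exact (hs hx).2 ζ hζx (ne_set_mem_of_le_of_le hIdown hIunion hg' le_rfl hζx.le
        (le_csSup ⟨b, hsb⟩ hx) hsup hmem)
    · obtain ⟨β, hβ, -⟩ := hunb 0 hpos
      obtain ⟨γ, hγ, hβγ⟩ := hunb β hβ.1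
      exact hγ.2 β hβγ (hall β hβ γ hγ hβγ.le)
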